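/- Fix δ₀ ∈ (0,1). For every γ < 1 there exists λ₀ > 0 such that for every 0 < λ < λ₀ and every E with δ₀ < |E| < 2 − δ₀ there is a constant C with: for every K > 1 there exists N₀ = N₀(K) such that for all N ≥ N₀ and all unit vectors u, w ∈ ℝ², 𝔼_ε[ min( ‖M_N(E;ε)‖ / |⟨M_N(E;ε) u, w⟩| , K ) ] ≤ C K^{1−γ}. -/

import Mathlib

noncomputable section

/-- Operator norm of a `2 × 2` real matrix acting on Euclidean `ℝ²`. -/
def opNorm (g : Matrix (Fin 2) (Fin 2) ℝ) : ℝ :=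
  ‖Matrix.toEuclideanCLM (𝕜 := ℝ) g‖

/-- Euclidean inner product on `ℝ²`. -/
def dot2 (u v : Fin 2 → ℝ) : ℝ := u 0 * v 0 + u 1 * v 1

/-- Euclidean norm on `ℝ²`. -/
def norm2 (u : Fin 2 → ℝ) : ℝ := Real.sqrt (u 0 ^ 2 + u 1 ^ 2)

/-- Single-step Anderson–Bernoulli matrix `g_E(ε) = [[E - λε, -1],[1,0]]`. -/
def gE (lam E x : ℝ) : Matrix (Fin 2) (Fin 2) ℝ := !![E - lam * x, -1; 1, 0]

/-- Transfer matrix `M_N(E;ε) = g_E(ε_N) ⋯ g_E(ε_1)`. -/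
def transfer (lam E : ℝ) (N : ℕ) (eps : Fin N → ℝ) : Matrix (Fin 2) (Fin 2) ℝ :=
  ((List.ofFn fun j => gE lam E (eps j)).reverse).prod

/-- `±1`-value of a Boolean (`true ↔ 1`, `false ↔ -1`). -/
def bval (b : Bool) : ℝ := if b then 1 else -1

/-- Transfer matrix with Bernoulli `±1` entries, cube encoded as `Fin N → Bool`. -/
def transferB (lam E : ℝ) (N : ℕ) (σ : Fin N → Bool) : Matrix (Fin 2) (Fin 2) ℝ :=
  transfer lam E N fun j => bval (σ j)

/-- Uniform measure of a subset of the Boolean cube `{1,-1}^N`. -/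
def mes {n : ℕ} (S : Set (Fin n → Bool)) : ℝ := by
  classical exact ((Finset.univ.filter fun ε => ε ∈ S).card : ℝ) / 2 ^ n

lemma one_add_rpow_neg_le {s h : ℝ} (hs : 0 < s) (hs1 : s < 1) (hh : |h| ≤ 1 / 2) :
    (1 + h) ^ (-s) ≤ 1 - s * h + s * (s + 1) / 2 * h ^ 2 + 30 * |h| ^ 3 := by
  have hpos : 0 < 1 + h := by linarith [(abs_le.1 hh).1]
  set l := Real.log (1 + h) with hl
  have h0 := abs_nonneg h
  have h3 : |l - (h - h ^ 2 / 2)| ≤ 2 * |h| ^ 3 := by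
    have := Real.abs_log_sub_add_sum_range_le (x := -h) (by rw [abs_neg]; linarith) 2
    simp only [Finset.sum_range_succ, Finset.sum_range_zero, abs_neg, sub_neg_eq_add] at this
    have e : |h| ^ 3 / (1 - |h|) ≤ 2 * |h| ^ 3 := by
      rw [div_le_iff₀ (by linarith)]
      nlinarith [pow_nonneg h0 3]
    norm_num at this
    refine le_trans (le_of_eq ?_) (this.trans e)
    rw [← hl]; congr 1; ring
  have hsq : h ^ 2 = |h| ^ 2 := (sq_abs h).symm
  obtain ⟨h3a, h3b⟩ := abs_le.1 h3
  have hc : |h| ^ 3 ≤ |h| ^ 2 / 2 := by nlinarith [pow_nonneg h0 2]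
  have hc2 : |h| ^ 2 ≤ |h| / 2 := by nlinarith
  have hlh : |l - h| ≤ 3 / 2 * |h| ^ 2 := by
    rw [abs_le]; constructor <;> nlinarith [pow_nonneg h0 2]
  have hl2 : |l| ≤ 2 * |h| := by
    have : |l| ≤ |l - h| + |h| := by simpa using abs_add_le (l - h) h
    linarith
  have hlsq : l ^ 2 ≤ h ^ 2 + 9 / 2 * |h| ^ 3 := by
    have h1 : l ^ 2 - h ^ 2 ≤ |l - h| * |l + h| := by
      rw [← abs_mul]; refine le_trans (le_of_eq ?_) (le_abs_self _); ring
    have h2 : |l + h| ≤ 3 * |h| := (abs_add_le _ _).trans (by linarith)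
    have := mul_le_mul hlh h2 (abs_nonneg _) (by positivity)
    nlinarith
  have hl3 : |l| ^ 3 ≤ 8 * |h| ^ 3 := by
    calc |l| ^ 3 ≤ (2 * |h|) ^ 3 := by gcongr
      _ = 8 * |h| ^ 3 := by ring
  have hx : |(-s * l)| ≤ 1 := by
    rw [abs_mul, abs_neg, abs_of_pos hs]; nlinarith [abs_nonneg l]
  have he : Real.exp (-s * l) ≤ 1 + (-s * l) + (-s * l) ^ 2 / 2 + |(-s * l)| ^ 3 := by
    generalize -s * l = y at hx
    have := Real.exp_bound hx (n := 3) (by norm_num)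
    simp [Finset.sum_range_succ, Nat.factorial] at this
    have := (abs_le.1 this).2
    nlinarith [pow_nonneg (abs_nonneg y) 3]
  have hx3 : |(-s * l)| ^ 3 ≤ 8 * |h| ^ 3 := by
    rw [abs_mul, abs_neg, abs_of_pos hs, mul_pow]
    have : s ^ 3 ≤ 1 := pow_le_one₀ hs.le hs1.le
    nlinarith [pow_nonneg (abs_nonneg l) 3]
  have hp := pow_nonneg h0 3
  have hs2 : s ^ 2 ≤ 1 := pow_le_one₀ hs.le hs1.le
  have t1 : -s * l ≤ -s * h + s * h ^ 2 / 2 + 2 * |h| ^ 3 := by nlinarith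
  have t2 : (-s * l) ^ 2 / 2 ≤ s ^ 2 * h ^ 2 / 2 + 9 / 4 * |h| ^ 3 := by
    have : s ^ 2 * l ^ 2 ≤ s ^ 2 * (h ^ 2 + 9 / 2 * |h| ^ 3) := by gcongr
    nlinarith
  rw [Real.rpow_def_of_pos hpos, ← hl, mul_comm l]
  nlinarith

/-- The angular corrector on `ℂ`, homogeneous of degree zero. -/
def corrector (a b z : ℂ) : ℝ := (a * (z / ‖z‖) ^ 2 + b * (z / ‖z‖) ^ 4).im

lemma abs_corrector_le {a b : ℂ} {B : ℝ} (ha : ‖a‖ ≤ B) (hb : ‖b‖ ≤ B) {z : ℂ} (hz : z ≠ 0) :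
    |corrector a b z| ≤ 2 * B := by
  have h1 : ‖z / (‖z‖ : ℂ)‖ = 1 := by
    rw [norm_div, Complex.norm_real, norm_norm, div_self (norm_ne_zero_iff.2 hz)]
  refine (Complex.abs_im_le_norm _).trans ((norm_add_le _ _).trans ?_)
  rw [norm_mul, norm_mul, norm_pow, norm_pow, h1]
  linarith

lemma corrector_sub_le {a b : ℂ} {B : ℝ} (ha : ‖a‖ ≤ B) (hb : ‖b‖ ≤ B) {z w : ℂ} {m : ℝ}
    (hz : z ≠ 0) (hw : ‖w‖ = 1) (hd : ‖z - w‖ ≤ m) :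
    corrector a b z ≤ corrector a b w + 12 * B * m := by
  have h1 : ‖z / (‖z‖ : ℂ)‖ = 1 := by
    rw [norm_div, Complex.norm_real, norm_norm, div_self (norm_ne_zero_iff.2 hz)]
  set v := z / (‖z‖ : ℂ) with hv
  have hw' : w / (‖w‖ : ℂ) = w := by simp [hw]
  have hvw : ‖v - w‖ ≤ 2 * m := by
    have e : v - w = v * ((1 - ‖z‖ : ℝ) : ℂ) + (z - w) := by
      have : (‖z‖ : ℂ) ≠ 0 := by exact_mod_cast norm_ne_zero_iff.2 hz
      rw [hv]; push_cast; field_simp; ring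
    rw [e]
    refine (norm_add_le _ _).trans ?_
    have := abs_norm_sub_norm_le z w
    rw [hw, abs_sub_comm] at this
    rw [norm_mul, h1, Complex.norm_real, Real.norm_eq_abs]
    linarith
  have hB : 0 ≤ B := (norm_nonneg a).trans ha
  have hm : 0 ≤ m := (norm_nonneg _).trans hd
  have h2 : ‖v ^ 2 - w ^ 2‖ ≤ 2 * (2 * m) := by
    have e : v ^ 2 - w ^ 2 = (v + w) * (v - w) := by ring
    rw [e, norm_mul]
    have : ‖v + w‖ ≤ 2 := (norm_add_le _ _).trans (by linarith)
    gcongr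
  have h4 : ‖v ^ 4 - w ^ 4‖ ≤ 2 * (2 * (2 * m)) := by
    have e : v ^ 4 - w ^ 4 = (v ^ 2 + w ^ 2) * (v ^ 2 - w ^ 2) := by ring
    rw [e, norm_mul]
    have : ‖v ^ 2 + w ^ 2‖ ≤ 2 := (norm_add_le _ _).trans (by rw [norm_pow, norm_pow, h1, hw]; norm_num)
    gcongr
  have key : corrector a b z - corrector a b w
      = (a * (v ^ 2 - w ^ 2) + b * (v ^ 4 - w ^ 4)).im := by
    unfold corrector
    rw [hw', ← hv, ← Complex.sub_im]; congr 1; ring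
  have : corrector a b z - corrector a b w ≤ B * (2 * (2 * m)) + B * (2 * (2 * (2 * m))) := by
    rw [key]
    refine (le_abs_self _).trans ((Complex.abs_im_le_norm _).trans ((norm_add_le _ _).trans ?_))
    rw [norm_mul, norm_mul]
    gcongr
  linarith

/-- The potential on `ℂ`: a negative power of the modulus with a small angular correction. -/
def potential (s m : ℝ) (a b z : ℂ) : ℝ :=
  Complex.normSq z ^ (-s) * (1 + m ^ 2 * corrector a b z)

/-- One step of the dynamics in rotated coordinates: a shear followed by a rotation. -/
def shearRot (ω : ℂ) (t : ℝ) (z : ℂ) : ℂ := ω * (z + Complex.I * ((t * z.re : ℝ) : ℂ))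

lemma normSq_shearRot {ω : ℂ} (hω : ‖ω‖ = 1) (t : ℝ) (z : ℂ) :
    Complex.normSq (shearRot ω t z)
      = Complex.normSq z + (2 * t * (z.re * z.im) + t ^ 2 * z.re ^ 2) := by
  unfold shearRot
  rw [map_mul, Complex.normSq_eq_norm_sq ω, hω]
  simp only [Complex.normSq_apply, Complex.add_re, Complex.add_im, Complex.mul_re, Complex.mul_im,
    Complex.I_re, Complex.I_im, Complex.ofReal_re, Complex.ofReal_im]
  ring

lemma potential_shearRot_le {s m B t : ℝ} {a b ω z : ℂ} (hs : 0 < s) (hs1 : s < 1)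
    (hω : ‖ω‖ = 1) (ha : ‖a‖ ≤ B) (hb : ‖b‖ ≤ B) (hB : 1 ≤ B) (hm : 0 < m) (hmB : 100 * B * m ≤ 1)
    (ht : |t| = m) (hz : ‖z‖ = 1) :
    potential s m a b (shearRot ω t z) ≤
      (1 - s * (2 * t * (z.re * z.im) + t ^ 2 * z.re ^ 2)
        + s * (s + 1) / 2 * (2 * t * (z.re * z.im) + t ^ 2 * z.re ^ 2) ^ 2 + 240 * m ^ 3)
      * (1 + m ^ 2 * corrector a b (ω * z) + 12 * B * m ^ 3) := by
  have hm1 : m ≤ 1 / 100 := by nlinarith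
  have hn : z.re ^ 2 + z.im ^ 2 = 1 := by
    have := Complex.normSq_eq_norm_sq z
    rw [hz, Complex.normSq_apply] at this; linarith
  have ht2 : t ^ 2 = m ^ 2 := by rw [← ht, sq_abs]
  set h := 2 * t * (z.re * z.im) + t ^ 2 * z.re ^ 2 with hh
  have habs : |h| ≤ 2 * m := by
    have h1 : |2 * (z.re * z.im)| ≤ 1 := by
      rw [abs_le]; constructor <;> nlinarith [sq_nonneg (z.re - z.im), sq_nonneg (z.re + z.im)]
    calc |h| ≤ |2 * t * (z.re * z.im)| + |t ^ 2 * z.re ^ 2| := abs_add_le _ _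
      _ = |t| * |2 * (z.re * z.im)| + t ^ 2 * z.re ^ 2 := by
        rw [← abs_mul, abs_of_nonneg (by positivity : 0 ≤ t ^ 2 * z.re ^ 2)]
        congr 2; ring
      _ ≤ m * 1 + m ^ 2 * 1 := by
        rw [ht, ht2]; gcongr; nlinarith [sq_nonneg z.im]
      _ ≤ 2 * m := by nlinarith
  have hN : Complex.normSq (shearRot ω t z) = 1 + h := by
    rw [normSq_shearRot hω, Complex.normSq_eq_norm_sq, hz]; norm_num [hh]
  have hpos : 0 < 1 + h := by have := (abs_le.1 habs).1; linarith
  have hne : shearRot ω t z ≠ 0 := by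
    rw [← Complex.normSq_pos, hN]; exact hpos
  have hdist : ‖shearRot ω t z - ω * z‖ ≤ m := by
    have e : shearRot ω t z - ω * z = ω * (Complex.I * ((t * z.re : ℝ) : ℂ)) := by
      unfold shearRot; ring
    rw [e, norm_mul, norm_mul, hω, Complex.norm_I, Complex.norm_real, Real.norm_eq_abs, abs_mul, ht]
    have : |z.re| ≤ 1 := hz ▸ Complex.abs_re_le_norm z
    nlinarith
  have hwz : ‖ω * z‖ = 1 := by rw [norm_mul, hω, hz, one_mul]
  have hc := corrector_sub_le ha hb hne hwz hdist
  have hcb := (abs_le.1 (abs_corrector_le ha hb hne)).1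
  have hr := one_add_rpow_neg_le hs hs1 (h := h) (by linarith)
  have h3 : |h| ^ 3 ≤ 8 * m ^ 3 := by
    calc |h| ^ 3 ≤ (2 * m) ^ 3 := by gcongr
      _ = 8 * m ^ 3 := by ring
  unfold potential
  rw [hN]
  have hm2 : 0 ≤ m ^ 2 := sq_nonneg m
  have hlow : 0 ≤ 1 + m ^ 2 * corrector a b (shearRot ω t z) := by nlinarith
  refine mul_le_mul (by linarith) (by nlinarith) hlow ?_
  exact (Real.rpow_nonneg hpos.le (-s)).trans (by linarith)

lemma corrector_rotation {s : ℝ} {a b ω z : ℂ} (hω : ‖ω‖ = 1) (hz : ‖z‖ = 1)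
    (ha : a * (ω ^ 2 - 1) = ((s / 2 : ℝ) : ℂ) * Complex.I)
    (hb : b * (ω ^ 4 - 1) = ((s * (s + 1) / 4 : ℝ) : ℂ) * Complex.I) :
    corrector a b (ω * z) = corrector a b z - s * (1 - s) / 4 + s * z.re ^ 2
      - 2 * s * (s + 1) * (z.re ^ 2 * z.im ^ 2) := by
  have hn : z.re ^ 2 + z.im ^ 2 = 1 := by
    have := Complex.normSq_eq_norm_sq z
    rw [hz, Complex.normSq_apply] at this; linarith
  have hwz : ‖ω * z‖ = 1 := by rw [norm_mul, hω, hz, one_mul]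
  have e : a * (ω * z) ^ 2 + b * (ω * z) ^ 4 = a * z ^ 2 + b * z ^ 4
      + (((s / 2 : ℝ) : ℂ) * Complex.I * z ^ 2 + ((s * (s + 1) / 4 : ℝ) : ℂ) * Complex.I * z ^ 4) := by
    rw [← ha, ← hb]; ring
  unfold corrector
  rw [hwz, hz]
  simp only [Complex.ofReal_one, div_one]
  rw [e, Complex.add_im]
  have h2 : (z ^ 2).re = z.re ^ 2 - z.im ^ 2 ∧ (z ^ 2).im = 2 * (z.re * z.im) := by
    exact ⟨by simp [pow_two], by simp [pow_two]; ring⟩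
  have h4 : (z ^ 4).re = (z.re ^ 2 - z.im ^ 2) ^ 2 - 4 * (z.re ^ 2 * z.im ^ 2) := by
    rw [show z ^ 4 = z ^ 2 * z ^ 2 by ring, Complex.mul_re, h2.1, h2.2]; ring
  have h5 : (((s / 2 : ℝ) : ℂ) * Complex.I * z ^ 2
      + ((s * (s + 1) / 4 : ℝ) : ℂ) * Complex.I * z ^ 4).im
      = s / 2 * (z ^ 2).re + s * (s + 1) / 4 * (z ^ 4).re := by
    simp [Complex.mul_im, Complex.mul_re]
  rw [h5, h2.1, h4]
  have hi : z.im ^ 2 = 1 - z.re ^ 2 := by linarith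
  rw [hi]; ring

lemma corrected_product_le {s m B F p q : ℝ} (hs : 0 < s) (hs1 : s < 1) (hB : 1 ≤ B)
    (hm : 0 < m) (hmB : 100000 * B * m ≤ s * (1 - s)) (hF1 : |F| ≤ 1) (hb0 : |q| ≤ 2 * B)
    (hb1 : |p| ≤ 2 * B) (hq : q = p - s * (1 - s) / 4 - F) :
    (1 + m ^ 2 * F + 241 * m ^ 3) * (1 + m ^ 2 * q + 12 * B * m ^ 3) ≤
      (1 - m ^ 2 * (s * (1 - s) / 8)) * (1 + m ^ 2 * p) := by
  have hss : s * (1 - s) ≤ 1 := by nlinarith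
  have hBm : 0 < B * m := by positivity
  have hm1 : m ≤ 1 / 100000 := by nlinarith
  have hm3 : 0 < m ^ 3 := by positivity
  have sq_mul_le : ∀ {y : ℝ}, y ≤ 2 * B → m ^ 2 * y ≤ 1 / 8 := by
    intro y hy
    calc m ^ 2 * y ≤ m ^ 2 * (2 * B) := by gcongr
      _ = 2 * m * (B * m) := by ring
      _ ≤ 2 * 1 * (1 / 16) := by gcongr <;> linarith
      _ = 1 / 8 := by norm_num
  have hcross : (F + 241 * m) * (q + 12 * B * m) ≤ 4000 * B := by
    have g1 : |F + 241 * m| ≤ 242 := (abs_add_le _ _).trans (by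
      rw [abs_of_pos (by positivity : 0 < 241 * m)]; linarith)
    have g2 : |q + 12 * B * m| ≤ 14 * B := (abs_add_le _ _).trans (by
      rw [abs_of_pos (by positivity : 0 < 12 * B * m)]
      nlinarith)
    calc (F + 241 * m) * (q + 12 * B * m) ≤ |F + 241 * m| * |q + 12 * B * m| := by
          rw [← abs_mul]; exact le_abs_self _
      _ ≤ 242 * (14 * B) := by gcongr
      _ ≤ 4000 * B := by linarith
  have e2 : (1 + m ^ 2 * F + 241 * m ^ 3) * (1 + m ^ 2 * q + 12 * B * m ^ 3)
      = 1 + m ^ 2 * (F + q) + m ^ 3 * (241 + 12 * B)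
        + m ^ 4 * ((F + 241 * m) * (q + 12 * B * m)) := by ring
  rw [e2]
  have e3 : m ^ 4 * ((F + 241 * m) * (q + 12 * B * m)) ≤ m ^ 3 * (4000 * B) := by
    calc _ ≤ m ^ 4 * (4000 * B) := by gcongr
      _ = m ^ 3 * (4000 * B) * m := by ring
      _ ≤ m ^ 3 * (4000 * B) := by
        have : 0 ≤ m ^ 3 * (4000 * B) := by positivity
        nlinarith
  have e4 : F + q = p - s * (1 - s) / 4 := by rw [hq]; ring
  rw [e4]
  have e5 : m ^ 3 * (241 + 12 * B) ≤ m ^ 3 * (300 * B) := by gcongr; linarith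
  have e6 : m ^ 2 * (5000 * B * m) ≤ m ^ 2 * (s * (1 - s) / 20) := by gcongr; linarith
  have e7 : m ^ 2 * (s * (1 - s) / 8) * (m ^ 2 * p) ≤ m ^ 2 * (s * (1 - s) / 20) := by
    have hs' : 0 ≤ s * (1 - s) := by nlinarith
    have : m ^ 2 * p ≤ 1 / 8 := sq_mul_le (abs_le.1 hb1).2
    calc m ^ 2 * (s * (1 - s) / 8) * (m ^ 2 * p) ≤ m ^ 2 * (s * (1 - s) / 8) * (1 / 8) := by gcongr
      _ ≤ _ := by nlinarith [mul_nonneg (sq_nonneg m) hs']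
  nlinarith

lemma abs_drift_le {s x : ℝ} (hs : 0 < s) (hs1 : s < 1) (hx0 : 0 ≤ x) (hx1 : x ≤ 1) :
    |-s * x + 2 * s * (s + 1) * (x * (1 - x))| ≤ 1 := by
  have hxx : x * (1 - x) ≤ 1 / 4 := by nlinarith [sq_nonneg (x - 1 / 2)]
  have hxx0 : 0 ≤ x * (1 - x) := mul_nonneg hx0 (by linarith)
  have hc0 : 0 ≤ 2 * s * (s + 1) := by positivity
  have hc4 : 2 * s * (s + 1) ≤ 4 := by nlinarith
  have hsx : s * x ≤ 1 := mul_le_one₀ hs1.le hx0 hx1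
  have hsx0 : 0 ≤ s * x := mul_nonneg hs.le hx0
  have h1 : 0 ≤ 2 * s * (s + 1) * (x * (1 - x)) := mul_nonneg hc0 hxx0
  have h2 : 2 * s * (s + 1) * (x * (1 - x)) ≤ 4 * (1 / 4) := by gcongr
  rw [abs_le]
  constructor <;> linarith

lemma average_potential_unit_le {s m B : ℝ} {a b ω z : ℂ} (hs : 0 < s) (hs1 : s < 1)
    (hω : ‖ω‖ = 1) (ha : ‖a‖ ≤ B) (hb : ‖b‖ ≤ B) (hB : 1 ≤ B)
    (ha' : a * (ω ^ 2 - 1) = ((s / 2 : ℝ) : ℂ) * Complex.I)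
    (hb' : b * (ω ^ 4 - 1) = ((s * (s + 1) / 4 : ℝ) : ℂ) * Complex.I)
    (hm : 0 < m) (hmB : 100000 * B * m ≤ s * (1 - s)) (hz : ‖z‖ = 1) :
    (potential s m a b (shearRot ω m z) + potential s m a b (shearRot ω (-m) z)) / 2 ≤
      (1 - m ^ 2 * (s * (1 - s) / 8)) * potential s m a b z := by
  have hss : s * (1 - s) ≤ 1 := by nlinarith
  have hBm : 0 < B * m := by positivity
  have hm1 : m ≤ 1 / 100000 := by nlinarith
  have h1 := potential_shearRot_le (z := z) hs hs1 hω ha hb hB hm (by nlinarith)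
    (abs_of_pos hm) hz
  have h2 := potential_shearRot_le (z := z) hs hs1 hω ha hb hB hm (by nlinarith)
    (by rw [abs_neg]; exact abs_of_pos hm : |-m| = m) hz
  have hz0 : z ≠ 0 := by rw [← norm_ne_zero_iff, hz]; norm_num
  have hwz0 : ω * z ≠ 0 := by rw [← norm_ne_zero_iff, norm_mul, hω, hz]; norm_num
  have hrot := corrector_rotation hω hz ha' hb'
  have hb0 := abs_le.1 (abs_corrector_le ha hb hwz0)
  have hb1 := abs_le.1 (abs_corrector_le ha hb hz0)
  have hn : z.re ^ 2 + z.im ^ 2 = 1 := by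
    have := Complex.normSq_eq_norm_sq z
    rw [hz, Complex.normSq_apply] at this; linarith
  have hpz : potential s m a b z = 1 + m ^ 2 * corrector a b z := by
    unfold potential; rw [Complex.normSq_eq_norm_sq, hz]; norm_num
  rw [hpz]
  set p := corrector a b z
  set q := corrector a b (ω * z)
  set x := z.re ^ 2 with hx
  have hy : z.im ^ 2 = 1 - x := by linarith
  have hx0 : 0 ≤ x := sq_nonneg _
  have hx1 : x ≤ 1 := by nlinarith [sq_nonneg z.im]
  set F := -s * x + 2 * s * (s + 1) * (x * z.im ^ 2) with hF
  have hq : q = p - s * (1 - s) / 4 - F := by rw [hrot, hF]; ring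
  have hF1 : |F| ≤ 1 := by
    rw [hF, hy]; exact abs_drift_le hs hs1 hx0 hx1
  have hm3 : 0 < m ^ 3 := by positivity
  have hD : 0 ≤ 1 + m ^ 2 * q + 12 * B * m ^ 3 := by
    have h1 : m ^ 2 * (-(2 * B)) ≤ m ^ 2 * q := by gcongr; exact hb0.1
    have h2 : m ^ 2 * (2 * B) ≤ 1 := by
      calc m ^ 2 * (2 * B) = 2 * m * (B * m) := by ring
        _ ≤ 2 * (1 / 2) * 1 := by gcongr <;> linarith
        _ = 1 := by norm_num
    have h3 : 0 ≤ 12 * B * m ^ 3 := by positivity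
    linarith
  have havg : (potential s m a b (shearRot ω m z) + potential s m a b (shearRot ω (-m) z)) / 2 ≤
      (1 + m ^ 2 * F + 241 * m ^ 3) * (1 + m ^ 2 * q + 12 * B * m ^ 3) := by
    have e : ((1 - s * (2 * m * (z.re * z.im) + m ^ 2 * x)
        + s * (s + 1) / 2 * (2 * m * (z.re * z.im) + m ^ 2 * x) ^ 2 + 240 * m ^ 3)
        + (1 - s * (2 * (-m) * (z.re * z.im) + (-m) ^ 2 * x)
        + s * (s + 1) / 2 * (2 * (-m) * (z.re * z.im) + (-m) ^ 2 * x) ^ 2 + 240 * m ^ 3)) / 2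
        ≤ 1 + m ^ 2 * F + 241 * m ^ 3 := by
      have e1 : s * (s + 1) / 2 * (m ^ 4 * x ^ 2) ≤ m ^ 3 := by
        have : s * (s + 1) ≤ 1 * 2 := by gcongr; linarith
        have : s * (s + 1) / 2 ≤ 1 := by linarith
        have : x ^ 2 ≤ 1 := pow_le_one₀ hx0 hx1
        calc s * (s + 1) / 2 * (m ^ 4 * x ^ 2) ≤ 1 * (m ^ 4 * 1) := by gcongr
          _ = m ^ 3 * m := by ring
          _ ≤ m ^ 3 := mul_le_of_le_one_right hm3.le (by linarith)
      refine le_of_eq_of_le (b := 1 + m ^ 2 * F + s * (s + 1) / 2 * (m ^ 4 * x ^ 2) + 240 * m ^ 3)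
        ?_ (by linarith)
      rw [hF, hx]; ring
    refine le_trans ?_ (mul_le_mul_of_nonneg_right e hD)
    rw [div_mul_eq_mul_div, add_mul]
    linarith
  exact havg.trans (corrected_product_le hs hs1 hB hm hmB hF1 (abs_le.2 hb0) (abs_le.2 hb1) hq)

lemma potential_real_mul {s m r : ℝ} (a b z : ℂ) (hr : 0 < r) :
    potential s m a b (r * z) = (r ^ 2) ^ (-s) * potential s m a b z := by
  have hc : corrector a b (r * z) = corrector a b z := by
    have : ((r : ℂ) * z) / ((‖(r : ℂ) * z‖ : ℝ) : ℂ) = z / ‖z‖ := by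
      rw [norm_mul, Complex.norm_real, Real.norm_eq_abs, abs_of_pos hr, Complex.ofReal_mul,
        mul_div_mul_left _ _ (by exact_mod_cast hr.ne')]
    unfold corrector; rw [this]
  unfold potential
  rw [hc, map_mul, Complex.normSq_ofReal, ← pow_two,
    Real.mul_rpow (by positivity) (Complex.normSq_nonneg z), mul_assoc]

lemma shearRot_real_mul (ω z : ℂ) (t r : ℝ) :
    shearRot ω t (r * z) = r * shearRot ω t z := by
  unfold shearRot
  rw [Complex.re_ofReal_mul]
  push_cast; ring

lemma average_potential_le {s m B : ℝ} {a b ω z : ℂ} (hs : 0 < s) (hs1 : s < 1)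
    (hω : ‖ω‖ = 1) (ha : ‖a‖ ≤ B) (hb : ‖b‖ ≤ B) (hB : 1 ≤ B)
    (ha' : a * (ω ^ 2 - 1) = ((s / 2 : ℝ) : ℂ) * Complex.I)
    (hb' : b * (ω ^ 4 - 1) = ((s * (s + 1) / 4 : ℝ) : ℂ) * Complex.I)
    (hm : 0 < m) (hmB : 100000 * B * m ≤ s * (1 - s)) (hz : z ≠ 0) :
    (potential s m a b (shearRot ω m z) + potential s m a b (shearRot ω (-m) z)) / 2 ≤
      (1 - m ^ 2 * (s * (1 - s) / 8)) * potential s m a b z := by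
  have hr : 0 < ‖z‖ := norm_pos_iff.2 hz
  have hrc : (‖z‖ : ℂ) ≠ 0 := by exact_mod_cast hr.ne'
  have hu : ‖z / (‖z‖ : ℂ)‖ = 1 := by
    rw [norm_div, Complex.norm_real, norm_norm, div_self hr.ne']
  have key := average_potential_unit_le hs hs1 hω ha hb hB ha' hb' hm hmB hu
  have e : z = (‖z‖ : ℂ) * (z / (‖z‖ : ℂ)) := by field_simp
  rw [e, shearRot_real_mul, shearRot_real_mul, potential_real_mul _ _ _ hr,
    potential_real_mul _ _ _ hr, potential_real_mul _ _ _ hr]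
  have hp : 0 ≤ (‖z‖ ^ 2) ^ (-s) := by positivity
  nlinarith [mul_le_mul_of_nonneg_left key hp]

/-- Squared Euclidean norm on `ℝ²`. -/
def nsq (v : Fin 2 → ℝ) : ℝ := v 0 ^ 2 + v 1 ^ 2

lemma nsq_nonneg (v : Fin 2 → ℝ) : 0 ≤ nsq v := by unfold nsq; positivity

/-- Coordinates in which `gE 0 (2 * C)` is a rotation. -/
def rotCoord (C S : ℝ) (v : Fin 2 → ℝ) : ℂ := ⟨S * v 0, v 1 - C * v 0⟩

lemma rotCoord_gE {lam C S e : ℝ} (hS : S ≠ 0) (hCS : C ^ 2 + S ^ 2 = 1) (v : Fin 2 → ℝ) :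
    rotCoord C S ((gE lam (2 * C) e).mulVec v) = shearRot ⟨C, S⟩ (e * (lam / S)) (rotCoord C S v) := by
  have h : e * (lam / S) * (S * v 0) = e * lam * v 0 := by field_simp
  have h0 : ((gE lam (2 * C) e).mulVec v) 0 = (2 * C - lam * e) * v 0 - v 1 := by
    simp only [gE, Matrix.mulVec, dotProduct, Fin.sum_univ_two]
    simp
    ring
  have h1 : ((gE lam (2 * C) e).mulVec v) 1 = v 0 := by
    simp [gE, Matrix.mulVec, dotProduct, Fin.sum_univ_two]
  apply Complex.ext
  · simp only [rotCoord, shearRot, h, h0, h1]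
    simp
    ring
  · simp only [rotCoord, shearRot, h, h0, h1]
    simp
    linear_combination (-v 0) * hCS

lemma nsq_le_normSq_rotCoord {C S : ℝ} (hCS : C ^ 2 + S ^ 2 = 1) (v : Fin 2 → ℝ) :
    (1 - |C|) * nsq v ≤ Complex.normSq (rotCoord C S v) ∧
      Complex.normSq (rotCoord C S v) ≤ 2 * nsq v := by
  have e : Complex.normSq (rotCoord C S v) = nsq v - 2 * C * (v 0 * v 1) := by
    rw [Complex.normSq_apply]
    simp only [rotCoord, nsq]
    linear_combination (v 0) ^ 2 * hCS
  have hC : |C| ≤ 1 := by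
    rw [← sq_le_one_iff_abs_le_one]; nlinarith [sq_nonneg S]
  have h2 : 2 * |v 0 * v 1| ≤ nsq v := by
    unfold nsq
    rcases abs_cases (v 0 * v 1) with ⟨h, -⟩ | ⟨h, -⟩ <;> rw [h]
    · nlinarith [sq_nonneg (v 0 - v 1)]
    · nlinarith [sq_nonneg (v 0 + v 1)]
  have h3 : |2 * C * (v 0 * v 1)| ≤ |C| * nsq v := by
    rw [abs_mul, abs_mul, abs_two]
    nlinarith [abs_nonneg C]
  have h4 := abs_le.1 h3
  have h5 : |C| * nsq v ≤ 1 * nsq v := mul_le_mul_of_nonneg_right hC (nsq_nonneg v)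
  rw [e]
  constructor <;> linarith

lemma rotation_coefficients {s C S δ : ℝ} (hs : 0 < s) (hs1 : s < 1) (hδ : 0 < δ) (hδ1 : δ < 1)
    (hCS : C ^ 2 + S ^ 2 = 1) (hC : δ / 2 ≤ |C|) (hS : δ / 2 ≤ S) :
    ∃ a b : ℂ, ‖a‖ ≤ 1 / δ ^ 2 ∧ ‖b‖ ≤ 1 / δ ^ 2 ∧
      a * ((⟨C, S⟩ : ℂ) ^ 2 - 1) = ((s / 2 : ℝ) : ℂ) * Complex.I ∧
      b * ((⟨C, S⟩ : ℂ) ^ 4 - 1) = ((s * (s + 1) / 4 : ℝ) : ℂ) * Complex.I := by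
  have hS0 : 0 < S := by linarith
  have hC0 : C ≠ 0 := by rw [← abs_pos]; linarith
  have hSc : (S : ℂ) ≠ 0 := by exact_mod_cast hS0.ne'
  have hCc : (C : ℂ) ≠ 0 := by exact_mod_cast hC0
  have hω : (⟨C, S⟩ : ℂ) = C + S * Complex.I := by apply Complex.ext <;> simp
  have hn : ‖(⟨C, -S⟩ : ℂ)‖ = 1 := by
    have h1 : ‖(⟨C, -S⟩ : ℂ)‖ ^ 2 = 1 := by
      rw [← Complex.normSq_eq_norm_sq, Complex.normSq_apply]; linear_combination hCS
    nlinarith [norm_nonneg (⟨C, -S⟩ : ℂ)]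
  have hω' : (⟨C, -S⟩ : ℂ) = C - S * Complex.I := by apply Complex.ext <;> simp
  have hCS' : (C : ℂ) ^ 2 + (S : ℂ) ^ 2 = 1 := by exact_mod_cast hCS
  have hprod : (⟨C, -S⟩ : ℂ) * ⟨C, S⟩ = 1 := by
    rw [hω, hω']; linear_combination hCS' - (S : ℂ) ^ 2 * Complex.I_sq
  refine ⟨((s / (4 * S) : ℝ) : ℂ) * ⟨C, -S⟩, ((s * (s + 1) / (16 * (S * C)) : ℝ) : ℂ) * ⟨C, -S⟩ ^ 2,
    ?_, ?_, ?_, ?_⟩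
  · rw [norm_mul, hn, Complex.norm_real, Real.norm_eq_abs, abs_of_pos (by positivity), mul_one,
      div_le_div_iff₀ (by positivity) (by positivity)]
    nlinarith
  · rw [norm_mul, norm_pow, hn, Complex.norm_real, Real.norm_eq_abs, one_pow, mul_one, abs_div,
      abs_mul (16 : ℝ), abs_mul S, abs_of_pos hS0, abs_of_pos (by positivity : 0 < s * (s + 1)),
      abs_of_pos (by norm_num : (0 : ℝ) < 16), div_le_div_iff₀ (by positivity) (by positivity)]
    have h1 : δ / 2 * (δ / 2) ≤ S * |C| := by gcongr
    have h2 : s * (s + 1) ≤ 1 * 2 := by gcongr; linarith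
    have h3 : s * (s + 1) * δ ^ 2 ≤ 2 * δ ^ 2 := by gcongr; linarith
    linarith [sq_nonneg δ]
  · have : (⟨C, -S⟩ : ℂ) * ((⟨C, S⟩ : ℂ) ^ 2 - 1) = 2 * S * Complex.I := by
      have : (⟨C, -S⟩ : ℂ) * ((⟨C, S⟩ : ℂ) ^ 2 - 1) = (⟨C, -S⟩ * ⟨C, S⟩) * ⟨C, S⟩ - ⟨C, -S⟩ := by ring
      rw [this, hprod, hω, hω']; ring
    rw [mul_assoc, this]; push_cast; field_simp; ring
  · have : (⟨C, -S⟩ : ℂ) ^ 2 * ((⟨C, S⟩ : ℂ) ^ 4 - 1) = 4 * (S * C) * Complex.I := by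
      have : (⟨C, -S⟩ : ℂ) ^ 2 * ((⟨C, S⟩ : ℂ) ^ 4 - 1)
        = (⟨C, -S⟩ * ⟨C, S⟩) ^ 2 * ⟨C, S⟩ ^ 2 - ⟨C, -S⟩ ^ 2 := by ring
      rw [this, hprod, hω, hω']; ring
    rw [mul_assoc, this]; push_cast; field_simp; ring

/-- A Lyapunov function for the projective action at small disorder. -/
lemma exists_lyapunov {δ₀ s : ℝ} (hδ₀ : 0 < δ₀) (hδ₀' : δ₀ < 1) (hs : 0 < s) (hs1 : s < 1) :
    ∃ lam0 : ℝ, 0 < lam0 ∧ ∀ lam : ℝ, 0 < lam → lam < lam0 →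
      ∀ E : ℝ, δ₀ < |E| → |E| < 2 - δ₀ →
        ∃ (V : (Fin 2 → ℝ) → ℝ) (q c : ℝ), 0 < q ∧ q < 1 ∧ 0 < c ∧ ∀ v : Fin 2 → ℝ, 0 < nsq v →
          nsq v ^ (-s) ≤ V v ∧ V v ≤ c * nsq v ^ (-s) ∧
          (V ((gE lam E (bval true)).mulVec v) + V ((gE lam E (bval false)).mulVec v)) / 2
            ≤ q * V v := by
  have hss : 0 < s * (1 - s) := mul_pos hs (by linarith)
  refine ⟨s * (1 - s) * δ₀ ^ 3 / 200000, by positivity, ?_⟩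
  intro lam hlam hlam0 E hE hE'
  set C := E / 2 with hC
  have hEC : E = 2 * C := by rw [hC]; ring
  have hCabs : |C| = |E| / 2 := by rw [hC, abs_div, abs_two]
  set S := Real.sqrt (1 - C ^ 2) with hSdef
  have hC2 : C ^ 2 ≤ (1 - δ₀ / 2) ^ 2 := by
    rw [← sq_abs C]; gcongr; linarith
  have hS2 : S ^ 2 = 1 - C ^ 2 := Real.sq_sqrt (by nlinarith)
  have hCS : C ^ 2 + S ^ 2 = 1 := by linarith
  have hSδ : δ₀ / 2 ≤ S := by
    apply Real.le_sqrt_of_sq_le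
    nlinarith
  have hS0 : 0 < S := by linarith
  obtain ⟨a, b, ha, hb, ha', hb'⟩ :=
    rotation_coefficients hs hs1 hδ₀ hδ₀' hCS (by rw [hCabs]; linarith) hSδ
  have hB : 1 ≤ 1 / δ₀ ^ 2 := by
    rw [le_div_iff₀ (by positivity), one_mul]; exact pow_le_one₀ hδ₀.le hδ₀'.le
  set m := lam / S with hm
  have hm0 : 0 < m := by positivity
  have hmδ : m ≤ 2 * lam / δ₀ := by
    rw [hm, div_le_div_iff₀ hS0 hδ₀]; nlinarith
  have hmB : 100000 * (1 / δ₀ ^ 2) * m ≤ s * (1 - s) := by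
    calc 100000 * (1 / δ₀ ^ 2) * m ≤ 100000 * (1 / δ₀ ^ 2) * (2 * lam / δ₀) := by gcongr
      _ = 200000 * lam / δ₀ ^ 3 := by field_simp; ring
      _ ≤ s * (1 - s) := by
        rw [div_le_iff₀ (by positivity)]; linarith
  have hω : ‖(⟨C, S⟩ : ℂ)‖ = 1 := by
    have h1 : ‖(⟨C, S⟩ : ℂ)‖ ^ 2 = 1 := by
      rw [← Complex.normSq_eq_norm_sq, Complex.normSq_apply]; linear_combination hCS
    nlinarith [norm_nonneg (⟨C, S⟩ : ℂ)]
  have hss1 : s * (1 - s) ≤ 1 := by nlinarith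
  have hBm : 1 / δ₀ ^ 2 * m ≤ 1 / 100000 := by linarith
  have hm1 : m ≤ 1 / 100000 := by nlinarith
  have hm2 : m ^ 2 * (2 * (1 / δ₀ ^ 2)) ≤ 1 / 2 := by
    calc m ^ 2 * (2 * (1 / δ₀ ^ 2)) = 2 * m * (1 / δ₀ ^ 2 * m) := by ring
      _ ≤ 2 * 1 * (1 / 4) := by gcongr <;> linarith
      _ = 1 / 2 := by norm_num
  have hC1 : 0 < 1 - |C| := by rw [hCabs]; linarith
  have hq : m ^ 2 * (s * (1 - s) / 8) < 1 := by
    have : m ^ 2 ≤ 1 := pow_le_one₀ hm0.le (by linarith)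
    calc m ^ 2 * (s * (1 - s) / 8) ≤ 1 * (1 / 8) := by gcongr
      _ < 1 := by norm_num
  refine ⟨fun v => 2 * 2 ^ s * potential s m a b (rotCoord C S v), 1 - m ^ 2 * (s * (1 - s) / 8),
    2 * 2 ^ s * ((1 - |C|) ^ (-s) * 2), by linarith, by linarith [show 0 < m ^ 2 * (s * (1 - s) / 8) by positivity], by positivity, ?_⟩
  intro v hv
  obtain ⟨h1, h2⟩ := nsq_le_normSq_rotCoord hCS v
  have hNpos : 0 < Complex.normSq (rotCoord C S v) := lt_of_lt_of_le (by positivity) h1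
  have hz : rotCoord C S v ≠ 0 := Complex.normSq_pos.1 hNpos
  have hcorr := abs_le.1 (abs_corrector_le ha hb hz)
  have hs0 : 0 ≤ nsq v ^ (-s) := by positivity
  have hs2 : 0 ≤ Complex.normSq (rotCoord C S v) ^ (-s) := by positivity
  have g1 : 1 / 2 ≤ 1 + m ^ 2 * corrector a b (rotCoord C S v) := by
    have : m ^ 2 * (-(2 * (1 / δ₀ ^ 2))) ≤ m ^ 2 * corrector a b (rotCoord C S v) := by
      gcongr; exact hcorr.1
    linarith
  have g2 : 1 + m ^ 2 * corrector a b (rotCoord C S v) ≤ 2 := by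
    have : m ^ 2 * corrector a b (rotCoord C S v) ≤ m ^ 2 * (2 * (1 / δ₀ ^ 2)) := by
      gcongr; exact hcorr.2
    linarith
  refine ⟨?_, ?_, ?_⟩
  · have h3 : (2 * nsq v) ^ (-s) ≤ Complex.normSq (rotCoord C S v) ^ (-s) :=
      Real.rpow_le_rpow_of_nonpos hNpos h2 (by linarith)
    rw [Real.mul_rpow (by norm_num) hv.le] at h3
    calc nsq v ^ (-s) = 2 * 2 ^ s * (2 ^ (-s) * nsq v ^ (-s) * (1 / 2)) := by
          rw [Real.rpow_neg (by norm_num : (0 : ℝ) ≤ 2)]; field_simp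
      _ ≤ 2 * 2 ^ s * potential s m a b (rotCoord C S v) := by
        unfold potential
        gcongr
  · have h3 : Complex.normSq (rotCoord C S v) ^ (-s) ≤ ((1 - |C|) * nsq v) ^ (-s) :=
      Real.rpow_le_rpow_of_nonpos (by positivity) h1 (by linarith)
    rw [Real.mul_rpow hC1.le hv.le] at h3
    calc 2 * 2 ^ s * potential s m a b (rotCoord C S v) ≤ 2 * 2 ^ s * ((1 - |C|) ^ (-s) * nsq v ^ (-s) * 2) := by
          unfold potential
          gcongr
      _ = _ := by ring
  · have key := average_potential_le hs hs1 hω ha hb hB ha' hb' hm0 hmB hz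
    have e1 : bval true = 1 := rfl
    have e2 : bval false = -1 := rfl
    simp only [hEC, rotCoord_gE hS0.ne' hCS, e1, e2, one_mul, neg_one_mul, ← hm]
    have h2s : (0 : ℝ) < 2 * 2 ^ s := by positivity
    have := mul_le_mul_of_nonneg_left key h2s.le
    linarith

/-- Average of a function over the words of length `n`. -/
def wordMean : ℕ → (List Bool → ℝ) → ℝ
  | 0, F => F []
  | n + 1, F => (wordMean n (fun l => F (true :: l)) + wordMean n (fun l => F (false :: l))) / 2

lemma sum_cube_div_eq_wordMean (n : ℕ) (F : List Bool → ℝ) :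
    (∑ σ : Fin n → Bool, F (List.ofFn σ)) / 2 ^ n = wordMean n F := by
  induction n generalizing F with
  | zero => simp [wordMean]
  | succ n ih =>
    rw [wordMean, ← ih, ← ih, ← (Fin.consEquiv (fun _ => Bool)).sum_comp, Fintype.sum_prod_type,
      Fintype.sum_bool]
    simp only [Fin.consEquiv, Equiv.coe_fn_mk, List.ofFn_cons, pow_succ]
    field_simp

lemma wordMean_mono {n : ℕ} {F H : List Bool → ℝ} (h : ∀ l, F l ≤ H l) :
    wordMean n F ≤ wordMean n H := by
  induction n generalizing F H with
  | zero => exact h []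
  | succ n ih =>
    have h1 := ih (fun l => h (true :: l))
    have h2 := ih (fun l => h (false :: l))
    simp only [wordMean]; linarith

lemma wordMean_add (n : ℕ) (F H : List Bool → ℝ) :
    wordMean n (fun l => F l + H l) = wordMean n F + wordMean n H := by
  induction n generalizing F H with
  | zero => rfl
  | succ n ih => simp only [wordMean, ih]; ring

lemma wordMean_const_mul (n : ℕ) (a : ℝ) (F : List Bool → ℝ) :
    wordMean n (fun l => a * F l) = a * wordMean n F := by
  induction n generalizing F with
  | zero => rfl
  | succ n ih => simp only [wordMean, ih]; ring

lemma wordMean_const (n : ℕ) (a : ℝ) : wordMean n (fun _ => a) = a := by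
  induction n with
  | zero => rfl
  | succ n ih => simp only [wordMean, ih]; ring

lemma wordMean_append (n k : ℕ) (F : List Bool → ℝ) :
    wordMean (n + k) F = wordMean n (fun l => wordMean k (fun l' => F (l ++ l'))) := by
  induction n generalizing F with
  | zero => simp [wordMean]
  | succ n ih => rw [Nat.add_right_comm]; simp only [wordMean, ih, List.cons_append]

lemma wordMean_comm (n k : ℕ) (F : List Bool → List Bool → ℝ) :
    wordMean n (fun l => wordMean k (F l)) = wordMean k (fun l' => wordMean n (fun l => F l l')) := by
  induction n generalizing F with
  | zero => rfl
  | succ n ih =>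
    simp only [wordMean, ih, div_eq_inv_mul, wordMean_const_mul, wordMean_add]

lemma wordMean_reverse (n : ℕ) (F : List Bool → ℝ) :
    wordMean n (fun l => F l.reverse) = wordMean n F := by
  induction n generalizing F with
  | zero => rfl
  | succ n ih =>
    rw [wordMean_append n 1]
    simp only [wordMean, div_eq_inv_mul, wordMean_const_mul, wordMean_add,
      List.reverse_append, List.reverse_singleton, List.singleton_append]
    rw [ih (fun l => F (true :: l)), ih (fun l => F (false :: l))]

/-- Product of matrices along a word, the first letter acting first. -/
def wordProd (G : Bool → Matrix (Fin 2) (Fin 2) ℝ) : List Bool → Matrix (Fin 2) (Fin 2) ℝ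
  | [] => 1
  | b :: l => wordProd G l * G b

lemma wordProd_append (G : Bool → Matrix (Fin 2) (Fin 2) ℝ) (l l' : List Bool) :
    wordProd G (l ++ l') = wordProd G l' * wordProd G l := by
  induction l with
  | nil => simp [wordProd]
  | cons b l ih => simp [wordProd, ih, Matrix.mul_assoc]

lemma wordProd_cons_mulVec (G : Bool → Matrix (Fin 2) (Fin 2) ℝ) (b : Bool) (l : List Bool)
    (v : Fin 2 → ℝ) :
    (wordProd G (b :: l)).mulVec v = (wordProd G l).mulVec ((G b).mulVec v) := by
  rw [wordProd, Matrix.mulVec_mulVec]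

lemma det_wordProd {G : Bool → Matrix (Fin 2) (Fin 2) ℝ} (hG : ∀ b, (G b).det = 1)
    (l : List Bool) : (wordProd G l).det = 1 := by
  induction l with
  | nil => simp [wordProd]
  | cons b l ih => rw [wordProd, Matrix.det_mul, ih, hG, one_mul]

lemma transferB_eq_wordProd (lam E : ℝ) (N : ℕ) (σ : Fin N → Bool) :
    transferB lam E N σ = wordProd (fun b => gE lam E (bval b)) (List.ofFn σ) := by
  have h : ∀ l : List Bool, ((l.map fun b => gE lam E (bval b)).reverse).prod
      = wordProd (fun b => gE lam E (bval b)) l := by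
    intro l
    induction l with
    | nil => rfl
    | cons b l ih => simp [wordProd, ih]
  rw [← h, transferB, transfer, List.map_ofFn]
  rfl

/-- Sum of `f` along the orbit of `v` under a word. -/
def orbitSum (G : Bool → Matrix (Fin 2) (Fin 2) ℝ) (f : (Fin 2 → ℝ) → ℝ) :
    List Bool → (Fin 2 → ℝ) → ℝ
  | [], v => f v
  | b :: l, v => f v + orbitSum G f l ((G b).mulVec v)

/-- Squared Frobenius norm. -/
def frobSq (M : Matrix (Fin 2) (Fin 2) ℝ) : ℝ := M 0 0 ^ 2 + M 0 1 ^ 2 + M 1 0 ^ 2 + M 1 1 ^ 2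

lemma frobSq_nonneg (M : Matrix (Fin 2) (Fin 2) ℝ) : 0 ≤ frobSq M := by
  unfold frobSq; positivity

/-- Rotation by a right angle. -/
def perp (v : Fin 2 → ℝ) : Fin 2 → ℝ := ![-v 1, v 0]

/-- Reflection in the first axis. -/
def conj2 (v : Fin 2 → ℝ) : Fin 2 → ℝ := ![v 0, -v 1]

lemma mulVec_zero_apply (M : Matrix (Fin 2) (Fin 2) ℝ) (v : Fin 2 → ℝ) :
    M.mulVec v 0 = M 0 0 * v 0 + M 0 1 * v 1 := by
  simp [Matrix.mulVec, dotProduct, Fin.sum_univ_two]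

lemma mulVec_one_apply (M : Matrix (Fin 2) (Fin 2) ℝ) (v : Fin 2 → ℝ) :
    M.mulVec v 1 = M 1 0 * v 0 + M 1 1 * v 1 := by
  simp [Matrix.mulVec, dotProduct, Fin.sum_univ_two]

lemma perp_zero (v : Fin 2 → ℝ) : perp v 0 = -v 1 := rfl
lemma perp_one (v : Fin 2 → ℝ) : perp v 1 = v 0 := rfl
lemma conj2_zero (v : Fin 2 → ℝ) : conj2 v 0 = v 0 := rfl
lemma conj2_one (v : Fin 2 → ℝ) : conj2 v 1 = -v 1 := rfl

lemma nsq_conj2 (v : Fin 2 → ℝ) : nsq (conj2 v) = nsq v := by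
  simp only [nsq, conj2_zero, conj2_one]; ring

lemma nsq_mulVec_add_perp (M : Matrix (Fin 2) (Fin 2) ℝ) (v : Fin 2 → ℝ) :
    nsq (M.mulVec v) + nsq (M.mulVec (perp v)) = frobSq M * nsq v := by
  simp only [nsq, frobSq, mulVec_zero_apply, mulVec_one_apply, perp_zero, perp_one]; ring

lemma nsq_mulVec_le (M : Matrix (Fin 2) (Fin 2) ℝ) (v : Fin 2 → ℝ) :
    nsq (M.mulVec v) ≤ frobSq M * nsq v := by
  linarith [nsq_mulVec_add_perp M v, nsq_nonneg (M.mulVec (perp v))]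

lemma nsq_le_mulVec {M : Matrix (Fin 2) (Fin 2) ℝ} (hM : M.det = 1) (v : Fin 2 → ℝ) :
    nsq v ≤ frobSq M * nsq (M.mulVec v) := by
  have h := nsq_mulVec_le !![M 1 1, -M 0 1; -M 1 0, M 0 0] (M.mulVec v)
  rw [Matrix.det_fin_two] at hM
  have e : (!![M 1 1, -M 0 1; -M 1 0, M 0 0] : Matrix (Fin 2) (Fin 2) ℝ).mulVec (M.mulVec v) = v := by
    ext i
    fin_cases i
    · simp [mulVec_zero_apply]
      linear_combination v 0 * hM
    · simp [mulVec_one_apply]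
      linear_combination v 1 * hM
  rw [e] at h
  refine h.trans_eq (congrArg (· * nsq (M.mulVec v)) ?_)
  simp [frobSq]; ring

lemma nsq_mulVec_pos {M : Matrix (Fin 2) (Fin 2) ℝ} (hM : M.det = 1) {v : Fin 2 → ℝ}
    (hv : 0 < nsq v) : 0 < nsq (M.mulVec v) := by
  have h := nsq_le_mulVec hM v
  by_contra hc
  have : nsq (M.mulVec v) = 0 := le_antisymm (not_lt.1 hc) (nsq_nonneg _)
  rw [this] at h; linarith

lemma nsq_smul_add_smul_le {x y : Fin 2 → ℝ} {k : ℝ} (hk : 0 ≤ k) (h : nsq y ≤ k ^ 2 * nsq x)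
    (a b : ℝ) : nsq (a • x + b • y) ≤ (|a| + |b| * k) ^ 2 * nsq x := by
  have hx := nsq_nonneg x
  have e : nsq (a • x + b • y)
      = a ^ 2 * nsq x + 2 * (a * b) * (x 0 * y 0 + x 1 * y 1) + b ^ 2 * nsq y := by
    simp [nsq]; ring
  have h1 : |x 0 * y 0 + x 1 * y 1| ≤ k * nsq x := by
    apply abs_le_of_sq_le_sq _ (by positivity)
    have : (x 0 * y 0 + x 1 * y 1) ^ 2 ≤ nsq x * nsq y := by
      unfold nsq; nlinarith [sq_nonneg (x 0 * y 1 - x 1 * y 0)]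
    calc _ ≤ nsq x * nsq y := this
      _ ≤ nsq x * (k ^ 2 * nsq x) := by gcongr
      _ = _ := by ring
  have h2 : a * b * (x 0 * y 0 + x 1 * y 1) ≤ |a| * |b| * (k * nsq x) := by
    calc _ ≤ |a * b * (x 0 * y 0 + x 1 * y 1)| := le_abs_self _
      _ = |a| * |b| * |x 0 * y 0 + x 1 * y 1| := by rw [abs_mul, abs_mul]
      _ ≤ _ := by gcongr
  have h3 : b ^ 2 * nsq y ≤ b ^ 2 * (k ^ 2 * nsq x) := by gcongr
  have e2 : (|a| + |b| * k) ^ 2 * nsq x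
      = a ^ 2 * nsq x + 2 * (|a| * |b| * (k * nsq x)) + b ^ 2 * (k ^ 2 * nsq x) := by
    rw [← sq_abs a, ← sq_abs b]; ring
  rw [e, e2]; linarith

lemma mulVec_perp_eq {M : Matrix (Fin 2) (Fin 2) ℝ} (hM : M.det = 1) {v : Fin 2 → ℝ}
    (hv : 0 < nsq v) : ∃ β : ℝ, |β| ≤ frobSq M ∧
      M.mulVec (perp v) = β • M.mulVec v + (nsq v / nsq (M.mulVec v)) • perp (M.mulVec v) := by
  have hp := nsq_mulVec_pos hM hv
  set x := M.mulVec v with hx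
  set y := M.mulVec (perp v) with hy
  have hF := frobSq_nonneg M
  refine ⟨(x 0 * y 0 + x 1 * y 1) / nsq x, ?_, ?_⟩
  · rw [abs_div, abs_of_pos hp, div_le_iff₀ hp]
    apply abs_le_of_sq_le_sq _ (by positivity)
    have h1 : (x 0 * y 0 + x 1 * y 1) ^ 2 ≤ nsq x * nsq y := by
      unfold nsq; nlinarith [sq_nonneg (x 0 * y 1 - x 1 * y 0)]
    have h2 : nsq y ≤ frobSq M * nsq v := by
      linarith [nsq_mulVec_add_perp M v, nsq_nonneg x]
    calc _ ≤ nsq x * nsq y := h1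
      _ ≤ nsq x * (frobSq M * (frobSq M * nsq x)) := by
        gcongr
        exact h2.trans (by gcongr; exact nsq_le_mulVec hM v)
      _ = _ := by ring
  · have hd : x 0 * y 1 - x 1 * y 0 = nsq v := by
      rw [Matrix.det_fin_two] at hM
      simp only [hx, hy, mulVec_zero_apply, mulVec_one_apply, perp_zero, perp_one, nsq]
      linear_combination (v 0 ^ 2 + v 1 ^ 2) * hM
    ext i
    fin_cases i
    · simp only [Fin.zero_eta, Pi.add_apply, Pi.smul_apply, smul_eq_mul, perp_zero]
      field_simp
      rw [← hd]; unfold nsq; ring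
    · simp only [Fin.mk_one, Pi.add_apply, Pi.smul_apply, smul_eq_mul, perp_one]
      field_simp
      rw [← hd]; unfold nsq; ring

lemma one_le_frobSq {M : Matrix (Fin 2) (Fin 2) ℝ} (hM : M.det = 1) : 1 ≤ frobSq M := by
  rw [Matrix.det_fin_two] at hM
  unfold frobSq
  nlinarith [sq_nonneg (M 0 0 - M 1 1), sq_nonneg (M 0 1 + M 1 0)]

section orbit

variable {G : Bool → Matrix (Fin 2) (Fin 2) ℝ}

lemma orbitSum_inv_nonneg (l : List Bool) (v : Fin 2 → ℝ) :
    0 ≤ orbitSum G (fun x => (nsq x)⁻¹) l v := by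
  induction l generalizing v with
  | nil => exact inv_nonneg.2 (nsq_nonneg _)
  | cons b l ih => exact add_nonneg (inv_nonneg.2 (nsq_nonneg _)) (ih _)

lemma inv_nsq_le_orbitSum (l : List Bool) (v : Fin 2 → ℝ) :
    (nsq v)⁻¹ ≤ orbitSum G (fun x => (nsq x)⁻¹) l v := by
  cases l with
  | nil => exact le_rfl
  | cons b l => exact le_add_of_nonneg_right (orbitSum_inv_nonneg _ _)

lemma inv_nsq_wordProd_le_orbitSum (l : List Bool) (v : Fin 2 → ℝ) :
    (nsq ((wordProd G l).mulVec v))⁻¹ ≤ orbitSum G (fun x => (nsq x)⁻¹) l v := by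
  induction l generalizing v with
  | nil => simp [wordProd, orbitSum]
  | cons b l ih =>
    rw [wordProd_cons_mulVec]
    exact (ih _).trans (le_add_of_nonneg_left (inv_nonneg.2 (nsq_nonneg _)))

lemma orbitSum_append_le (l l' : List Bool) (v : Fin 2 → ℝ) :
    orbitSum G (fun x => (nsq x)⁻¹) (l ++ l') v ≤ orbitSum G (fun x => (nsq x)⁻¹) l v +
      orbitSum G (fun x => (nsq x)⁻¹) l' ((wordProd G l).mulVec v) := by
  induction l generalizing v with
  | nil =>
    simp only [List.nil_append, wordProd, Matrix.one_mulVec, orbitSum]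
    exact le_add_of_nonneg_left (inv_nonneg.2 (nsq_nonneg _))
  | cons b l ih =>
    rw [wordProd_cons_mulVec, List.cons_append]
    simp only [orbitSum]
    linarith [ih ((G b).mulVec v)]

lemma orbitSum_inv_rpow_le {V : (Fin 2 → ℝ) → ℝ} {s : ℝ} (hs : 0 < s) (hs1 : s < 1)
    (hG : ∀ b, (G b).det = 1) (hV : ∀ v, 0 < nsq v → nsq v ^ (-s) ≤ V v) (l : List Bool)
    {v : Fin 2 → ℝ} (hv : 0 < nsq v) :
    orbitSum G (fun x => (nsq x)⁻¹) l v ^ s ≤ orbitSum G V l v := by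
  have h0 : ∀ v, 0 < nsq v → ((nsq v)⁻¹) ^ s ≤ V v := by
    intro v hv
    rw [Real.inv_rpow hv.le, ← Real.rpow_neg hv.le]; exact hV v hv
  induction l generalizing v with
  | nil => exact h0 v hv
  | cons b l ih =>
    simp only [orbitSum]
    calc _ ≤ ((nsq v)⁻¹) ^ s + orbitSum G (fun x => (nsq x)⁻¹) l ((G b).mulVec v) ^ s :=
          Real.rpow_add_le_add_rpow (inv_nonneg.2 hv.le) (orbitSum_inv_nonneg _ _) hs.le hs1.le
      _ ≤ _ := add_le_add (h0 v hv) (ih (nsq_mulVec_pos (hG b) hv))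

lemma wordMean_orbitSum_le {V : (Fin 2 → ℝ) → ℝ} {q : ℝ} (hq : q < 1)
    (hG : ∀ b, (G b).det = 1) (hV0 : ∀ v, 0 < nsq v → 0 ≤ V v)
    (hV : ∀ v, 0 < nsq v → (V ((G true).mulVec v) + V ((G false).mulVec v)) / 2 ≤ q * V v)
    (n : ℕ) {v : Fin 2 → ℝ} (hv : 0 < nsq v) :
    wordMean n (fun l => orbitSum G V l v) ≤ V v / (1 - q) := by
  have hq1 : 0 < 1 - q := by linarith
  induction n generalizing v with
  | zero =>
    have h1 := nsq_mulVec_pos (hG true) hv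
    have h2 := nsq_mulVec_pos (hG false) hv
    have h3 : 0 ≤ q * V v := le_trans (by linarith [hV0 _ h1, hV0 _ h2]) (hV v hv)
    simp only [wordMean, orbitSum]
    rw [le_div_iff₀ hq1]; linarith
  | succ n ih =>
    simp only [wordMean, orbitSum, wordMean_add, wordMean_const]
    have h1 := ih (nsq_mulVec_pos (hG true) hv)
    have h2 := ih (nsq_mulVec_pos (hG false) hv)
    have h3 := div_le_div_of_nonneg_right (hV v hv) hq1.le
    have h4 : V v / (1 - q) = V v + q * V v / (1 - q) := by field_simp; ring
    have h5 : (V ((G true).mulVec v) + V ((G false).mulVec v)) / 2 / (1 - q)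
      = (V ((G true).mulVec v) / (1 - q) + V ((G false).mulVec v) / (1 - q)) / 2 := by ring
    rw [h4]; linarith

lemma wordMean_wordProd_le {V : (Fin 2 → ℝ) → ℝ} {q : ℝ} (hq : 0 < q)
    (hG : ∀ b, (G b).det = 1)
    (hV : ∀ v, 0 < nsq v → (V ((G true).mulVec v) + V ((G false).mulVec v)) / 2 ≤ q * V v)
    (n : ℕ) {v : Fin 2 → ℝ} (hv : 0 < nsq v) :
    wordMean n (fun l => V ((wordProd G l).mulVec v)) ≤ q ^ n * V v := by
  induction n generalizing v with
  | zero => simp [wordMean, wordProd]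
  | succ n ih =>
    simp only [wordMean, wordProd_cons_mulVec]
    have h1 := ih (nsq_mulVec_pos (hG true) hv)
    have h2 := ih (nsq_mulVec_pos (hG false) hv)
    have h3 := mul_le_mul_of_nonneg_left (hV v hv) (pow_nonneg hq.le n)
    rw [pow_succ]; linarith

lemma nsq_wordProd_perp_le {A : ℝ} (hG : ∀ b, (G b).det = 1) (hA : ∀ b, frobSq (G b) ≤ A)
    (l : List Bool) {v : Fin 2 → ℝ} (hv : 0 < nsq v) :
    nsq ((wordProd G l).mulVec (perp v)) ≤
      (A * orbitSum G (fun x => (nsq x)⁻¹) l v * nsq v) ^ 2 * nsq ((wordProd G l).mulVec v) := by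
  have hA1 : 1 ≤ A := (one_le_frobSq (hG true)).trans (hA true)
  induction l generalizing v with
  | nil =>
    simp only [wordProd, Matrix.one_mulVec, orbitSum]
    rw [mul_assoc, inv_mul_cancel₀ hv.ne', mul_one]
    have : nsq (perp v) = nsq v := by simp only [nsq, perp_zero, perp_one]; ring
    rw [this]
    exact le_mul_of_one_le_left hv.le (one_le_pow₀ hA1)
  | cons b l ih =>
    have hp := nsq_mulVec_pos (hG b) hv
    have hT := orbitSum_inv_nonneg (G := G) l ((G b).mulVec v)
    obtain ⟨β, hβ, e⟩ := mulVec_perp_eq (hG b) hv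
    rw [wordProd_cons_mulVec, wordProd_cons_mulVec, e, Matrix.mulVec_add, Matrix.mulVec_smul,
      Matrix.mulVec_smul]
    refine (nsq_smul_add_smul_le (by positivity) (ih hp) _ _).trans ?_
    refine mul_le_mul_of_nonneg_right (pow_le_pow_left₀ (by positivity) ?_ 2) (nsq_nonneg _)
    rw [abs_of_pos (div_pos hv hp)]
    simp only [orbitSum]
    calc _ = |β| + A * orbitSum G (fun x => (nsq x)⁻¹) l ((G b).mulVec v) * nsq v := by
          field_simp
      _ ≤ A + A * orbitSum G (fun x => (nsq x)⁻¹) l ((G b).mulVec v) * nsq v := by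
          gcongr; exact hβ.trans (hA b)
      _ = _ := by field_simp

lemma frobSq_wordProd_le {A : ℝ} (hG : ∀ b, (G b).det = 1) (hA : ∀ b, frobSq (G b) ≤ A)
    (l : List Bool) {v : Fin 2 → ℝ} (hv : nsq v = 1) :
    frobSq (wordProd G l) ≤ 2 * (A * orbitSum G (fun x => (nsq x)⁻¹) l v) ^ 2 *
      nsq ((wordProd G l).mulVec v) := by
  have hA1 : 1 ≤ A := (one_le_frobSq (hG true)).trans (hA true)
  have h := nsq_wordProd_perp_le hG hA l (v := v) (by linarith)
  have e := nsq_mulVec_add_perp (wordProd G l) v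
  have hT := inv_nsq_le_orbitSum (G := G) l v
  rw [hv, inv_one] at hT
  rw [hv, mul_one] at h e
  have h1 : 1 ≤ (A * orbitSum G (fun x => (nsq x)⁻¹) l v) ^ 2 :=
    one_le_pow₀ (one_le_mul_of_one_le_of_one_le hA1 hT)
  nlinarith [nsq_nonneg ((wordProd G l).mulVec v)]

end orbit

lemma opNorm_sq_le_frobSq (M : Matrix (Fin 2) (Fin 2) ℝ) : opNorm M ^ 2 ≤ frobSq M := by
  have h : opNorm M ≤ √(frobSq M) := by
    refine ContinuousLinearMap.opNorm_le_bound _ (Real.sqrt_nonneg _) fun x => ?_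
    rw [EuclideanSpace.norm_eq, EuclideanSpace.norm_eq, ← Real.sqrt_mul (frobSq_nonneg M)]
    apply Real.sqrt_le_sqrt
    simp only [Matrix.ofLp_toEuclideanCLM, Fin.sum_univ_two, Real.norm_eq_abs, sq_abs]
    exact nsq_mulVec_le M x.ofLp
  calc opNorm M ^ 2 ≤ √(frobSq M) ^ 2 := pow_le_pow_left₀ (norm_nonneg _) h 2
    _ = frobSq M := Real.sq_sqrt (frobSq_nonneg M)

lemma nsq_mul_nsq_transpose_le {M : Matrix (Fin 2) (Fin 2) ℝ} (hM : M.det = 1)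
    {u w : Fin 2 → ℝ} (hu : nsq u = 1) (hw : nsq w = 1) :
    nsq (M.mulVec u) * nsq (M.transpose.mulVec w) ≤
      (|dot2 (M.mulVec u) w| * √(frobSq M) + 1) ^ 2 := by
  set a := dot2 (M.mulVec u) w with ha
  set b := dot2 (M.mulVec (perp u)) w with hb
  set c := dot2 (M.mulVec u) (perp w) with hc
  set d := dot2 (M.mulVec (perp u)) (perp w) with hd
  have h1 : a ^ 2 + c ^ 2 = nsq (M.mulVec u) := by
    have : a ^ 2 + c ^ 2 = nsq (M.mulVec u) * nsq w := by
      simp only [ha, hc, dot2, nsq, perp_zero, perp_one]; ring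
    rw [this, hw, mul_one]
  have h2 : a ^ 2 + b ^ 2 = nsq (M.transpose.mulVec w) := by
    have : a ^ 2 + b ^ 2 = nsq (M.transpose.mulVec w) * nsq u := by
      simp only [ha, hb, dot2, nsq, perp_zero, perp_one, mulVec_zero_apply, mulVec_one_apply,
        Matrix.transpose_apply]
      ring
    rw [this, hu, mul_one]
  have h3 : b ^ 2 + d ^ 2 = nsq (M.mulVec (perp u)) := by
    have : b ^ 2 + d ^ 2 = nsq (M.mulVec (perp u)) * nsq w := by
      simp only [hb, hd, dot2, nsq, perp_zero, perp_one]; ring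
    rw [this, hw, mul_one]
  have h4 : a ^ 2 + b ^ 2 + c ^ 2 + d ^ 2 = frobSq M := by
    have := nsq_mulVec_add_perp M u
    rw [hu, mul_one] at this
    linarith
  have h5 : a * d - b * c = 1 := by
    have : a * d - b * c = M.det * nsq u * nsq w := by
      rw [Matrix.det_fin_two]
      simp only [ha, hb, hc, hd, dot2, nsq, perp_zero, perp_one, mulVec_zero_apply,
        mulVec_one_apply]
      ring
    rw [this, hM, hu, hw]; norm_num
  have hF := Real.sq_sqrt (frobSq_nonneg M)
  have h6 : |d| ≤ √(frobSq M) := by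
    apply Real.abs_le_sqrt
    rw [← h4]; nlinarith [sq_nonneg a, sq_nonneg b, sq_nonneg c]
  have h7 : -(a * d) ≤ |a| * √(frobSq M) := by
    calc -(a * d) ≤ |a * d| := neg_le_abs _
      _ = |a| * |d| := abs_mul _ _
      _ ≤ _ := by gcongr
  have h8 : (a ^ 2 + c ^ 2) * (a ^ 2 + b ^ 2) = a ^ 2 * frobSq M - 2 * (a * d) + 1 := by
    rw [← h4]; linear_combination (1 - a * d - b * c) * h5
  have h9 : (|a| * √(frobSq M) + 1) ^ 2
      = a ^ 2 * frobSq M + 2 * (|a| * √(frobSq M)) + 1 := by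
    rw [← sq_abs a]; linear_combination |a| ^ 2 * hF
  rw [← h1, ← h2, h8, h9]; linarith

lemma opNorm_div_dot2_le {M : Matrix (Fin 2) (Fin 2) ℝ} (hM : M.det = 1)
    {u w : Fin 2 → ℝ} (hu : nsq u = 1) (hw : nsq w = 1) {t t' : ℝ} (ht : 0 ≤ t) (ht' : 0 ≤ t')
    (hR : 4 ≤ nsq (M.mulVec u)) (hQ : 4 ≤ nsq (M.transpose.mulVec w))
    (h : frobSq M ≤ 2 * t ^ 2 * nsq (M.mulVec u))
    (h' : frobSq M ≤ 2 * t' ^ 2 * nsq (M.transpose.mulVec w)) :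
    dot2 (M.mulVec u) w ≠ 0 ∧ opNorm M / |dot2 (M.mulVec u) w| ≤ 4 * (t * t') := by
  have key := nsq_mul_nsq_transpose_le hM hu hw
  set R := nsq (M.mulVec u)
  set Q := nsq (M.transpose.mulVec w)
  set a := dot2 (M.mulVec u) w
  set P := √(frobSq M) with hP
  have hP0 : 0 ≤ P := Real.sqrt_nonneg _
  have hPF : P ^ 2 = frobSq M := Real.sq_sqrt (frobSq_nonneg M)
  have hRQ : 16 ≤ R * Q := by nlinarith
  set Z := √(R * Q) with hZ
  have hZ4 : 4 ≤ Z := Real.le_sqrt_of_sq_le (by linarith)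
  have hZ2 : Z ^ 2 = R * Q := Real.sq_sqrt (by linarith)
  have h1 : Z ≤ |a| * P + 1 := Real.sqrt_le_iff.2 ⟨by positivity, key⟩
  have h2 : P ^ 2 ≤ 2 * (t * t') * Z := by
    apply le_of_sq_le_sq _ (by positivity)
    rw [← hPF] at h h'
    calc (P ^ 2) ^ 2 = P ^ 2 * P ^ 2 := by ring
      _ ≤ (2 * t ^ 2 * R) * (2 * t' ^ 2 * Q) := by
        apply mul_le_mul h h' (by positivity)
        have : 0 ≤ R := by linarith
        positivity
      _ = (2 * (t * t')) ^ 2 * (R * Q) := by ring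
      _ = _ := by rw [← hZ2]; ring
  have ha : 0 < |a| * P := by linarith
  have ha0 : 0 < |a| := pos_of_mul_pos_left ha hP0
  have hPpos : 0 < P := pos_of_mul_pos_right ha ha0.le
  refine ⟨abs_pos.1 ha0, ?_⟩
  have h3 : opNorm M ≤ P := Real.le_sqrt_of_sq_le (opNorm_sq_le_frobSq M)
  rw [div_le_iff₀ ha0]
  refine h3.trans ?_
  have h4 : P * P ≤ 4 * (t * t') * |a| * P := by
    have : 2 * (t * t') * Z ≤ 2 * (t * t') * (2 * (|a| * P)) := by
      gcongr; linarith
    nlinarith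
  exact le_of_mul_le_mul_right h4 hPpos

lemma conj2_conj2 (v : Fin 2 → ℝ) : conj2 (conj2 v) = v := by
  ext i; fin_cases i <;> simp [conj2]

section transpose

variable {G : Bool → Matrix (Fin 2) (Fin 2) ℝ}

lemma transpose_wordProd_mulVec
    (hT : ∀ b v, (G b).transpose.mulVec v = conj2 ((G b).mulVec (conj2 v)))
    (l : List Bool) (w : Fin 2 → ℝ) :
    (wordProd G l).transpose.mulVec w = conj2 ((wordProd G l.reverse).mulVec (conj2 w)) := by
  induction l generalizing w with
  | nil => simp [wordProd, conj2_conj2]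
  | cons b l ih =>
    rw [List.reverse_cons, wordProd_append, wordProd, Matrix.transpose_mul,
      ← Matrix.mulVec_mulVec, ih, hT, conj2_conj2, ← Matrix.mulVec_mulVec]
    simp [wordProd]

lemma frobSq_wordProd_reverse
    (hT : ∀ b v, (G b).transpose.mulVec v = conj2 ((G b).mulVec (conj2 v)))
    (l : List Bool) : frobSq (wordProd G l.reverse) = frobSq (wordProd G l) := by
  have h1 := transpose_wordProd_mulVec hT l ![1, 0]
  have h2 := transpose_wordProd_mulVec hT l ![0, 1]
  have a1 := congrFun h1 0
  have a2 := congrFun h1 1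
  have a3 := congrFun h2 0
  have a4 := congrFun h2 1
  simp only [mulVec_zero_apply, mulVec_one_apply, conj2_zero, conj2_one,
    Matrix.transpose_apply] at a1 a2 a3 a4
  simp at a1 a2 a3 a4
  unfold frobSq
  rw [a1, a2, a3, a4]; ring

end transpose

/-- The truncated ratio `min(‖M‖ / |⟨M u, w⟩|, K)`. -/
def truncRatio (K : ℝ) (M : Matrix (Fin 2) (Fin 2) ℝ) (u w : Fin 2 → ℝ) : ℝ :=
  if dot2 (M.mulVec u) w = 0 then K else min (opNorm M / |dot2 (M.mulVec u) w|) K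

lemma truncRatio_le (K : ℝ) (M : Matrix (Fin 2) (Fin 2) ℝ) (u w : Fin 2 → ℝ) :
    truncRatio K M u w ≤ K := by
  unfold truncRatio
  split_ifs
  · exact le_rfl
  · exact min_le_right _ _

lemma truncRatio_le_rpow {K Y s : ℝ} (hK : 1 < K) (hs : 0 < s) (hs1 : s < 1)
    {M : Matrix (Fin 2) (Fin 2) ℝ} {u w : Fin 2 → ℝ} (h0 : dot2 (M.mulVec u) w ≠ 0)
    (hY : opNorm M / |dot2 (M.mulVec u) w| ≤ Y) :
    truncRatio K M u w ≤ K ^ (1 - s) * Y ^ s := by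
  have hX : 0 ≤ opNorm M / |dot2 (M.mulVec u) w| := div_nonneg (norm_nonneg _) (abs_nonneg _)
  have hY0 := hX.trans hY
  rw [truncRatio, if_neg h0]
  set m := min (opNorm M / |dot2 (M.mulVec u) w|) K with hm
  have hm0 : 0 ≤ m := le_min hX (by linarith)
  calc m = m ^ (1 - s) * m ^ s := by
        rw [← Real.rpow_add_of_nonneg hm0 (by linarith) hs.le]; simp
    _ ≤ _ := by
      gcongr
      · exact min_le_right _ _
      · exact (min_le_left _ _).trans hY

section words

variable {G : Bool → Matrix (Fin 2) (Fin 2) ℝ}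

lemma truncRatio_wordProd_le {V : (Fin 2 → ℝ) → ℝ} {s A K : ℝ} (hs : 0 < s) (hs1 : s < 1)
    (hG : ∀ b, (G b).det = 1) (hA : ∀ b, frobSq (G b) ≤ A)
    (hT : ∀ b v, (G b).transpose.mulVec v = conj2 ((G b).mulVec (conj2 v)))
    (hV : ∀ v, 0 < nsq v → nsq v ^ (-s) ≤ V v) (hK : 1 < K)
    {u w : Fin 2 → ℝ} (hu : nsq u = 1) (hw : nsq w = 1) (l l' : List Bool) :
    truncRatio K (wordProd G (l ++ l')) u w ≤
      K * 4 ^ s * orbitSum G V l' ((wordProd G l).mulVec u) +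
      K * 4 ^ s * orbitSum G V l.reverse ((wordProd G l'.reverse).mulVec (conj2 w)) +
      K ^ (1 - s) * (16 * A ^ 2) ^ s *
        (orbitSum G V l u * orbitSum G V l'.reverse (conj2 w)) := by
  have hA1 : 1 ≤ A := (one_le_frobSq (hG true)).trans (hA true)
  have hwc : nsq (conj2 w) = 1 := by rw [nsq_conj2, hw]
  have hu0 : 0 < nsq u := by linarith
  have hw0 : 0 < nsq (conj2 w) := by linarith
  have hul := nsq_mulVec_pos (det_wordProd hG l) hu0
  have hwl := nsq_mulVec_pos (det_wordProd hG l'.reverse) hw0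
  have hS : ∀ (k : List Bool) {v : Fin 2 → ℝ}, 0 < nsq v →
      orbitSum G (fun x => (nsq x)⁻¹) k v ^ s ≤ orbitSum G V k v :=
    fun k v hv => orbitSum_inv_rpow_le hs hs1 hG hV k hv
  have hS0 : ∀ (k : List Bool) {v : Fin 2 → ℝ}, 0 < nsq v → 0 ≤ orbitSum G V k v :=
    fun k v hv => (Real.rpow_nonneg (orbitSum_inv_nonneg k v) s).trans (hS k hv)
  have hlarge : ∀ (k : List Bool) {v : Fin 2 → ℝ}, 0 < nsq v →
      1 / 4 < orbitSum G (fun x => (nsq x)⁻¹) k v → K ≤ K * 4 ^ s * orbitSum G V k v := by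
    intro k v hv h
    have h1 : 1 ≤ (4 * orbitSum G (fun x => (nsq x)⁻¹) k v) ^ s :=
      Real.one_le_rpow (by linarith) hs.le
    rw [Real.mul_rpow (by norm_num) (orbitSum_inv_nonneg k v)] at h1
    have h2 : (1 : ℝ) ≤ 4 ^ s * orbitSum G V k v :=
      h1.trans (by gcongr; exact hS k hv)
    rw [mul_assoc]
    exact le_mul_of_one_le_right (by linarith) h2
  have p1 := hS0 l' hul
  have p2 := hS0 l.reverse hwl
  have p3 := hS0 l hu0
  have p4 := hS0 l'.reverse hw0
  have t1 : 0 ≤ K * 4 ^ s * orbitSum G V l' ((wordProd G l).mulVec u) := by positivity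
  have t2 : 0 ≤ K * 4 ^ s * orbitSum G V l.reverse ((wordProd G l'.reverse).mulVec (conj2 w)) := by
    positivity
  have t3 : 0 ≤ K ^ (1 - s) * (16 * A ^ 2) ^ s *
        (orbitSum G V l u * orbitSum G V l'.reverse (conj2 w)) := by positivity
  have hK' := truncRatio_le K (wordProd G (l ++ l')) u w
  by_cases b1 : 1 / 4 < orbitSum G (fun x => (nsq x)⁻¹) l' ((wordProd G l).mulVec u)
  · linarith [hlarge l' hul b1]
  by_cases b2 : 1 / 4 < orbitSum G (fun x => (nsq x)⁻¹) l.reverse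
      ((wordProd G l'.reverse).mulVec (conj2 w))
  · linarith [hlarge l.reverse hwl b2]
  rw [not_lt] at b1 b2
  have hlast : ∀ (k k' : List Bool) {v : Fin 2 → ℝ}, nsq v = 1 →
      orbitSum G (fun x => (nsq x)⁻¹) k' ((wordProd G k).mulVec v) ≤ 1 / 4 →
      4 ≤ nsq ((wordProd G (k ++ k')).mulVec v) ∧
      orbitSum G (fun x => (nsq x)⁻¹) (k ++ k') v ≤
        2 * orbitSum G (fun x => (nsq x)⁻¹) k v := by
    intro k k' v hv h
    have h1 := inv_nsq_wordProd_le_orbitSum (G := G) k' ((wordProd G k).mulVec v)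
    have h2 := inv_nsq_le_orbitSum (G := G) k v
    rw [hv, inv_one] at h2
    have h3 := nsq_mulVec_pos (det_wordProd hG (k ++ k')) (v := v) (by linarith)
    refine ⟨?_, by linarith [orbitSum_append_le (G := G) k k' v]⟩
    rw [wordProd_append, ← Matrix.mulVec_mulVec] at h3 ⊢
    have h4 := h1.trans h
    rw [inv_le_comm₀ h3 (by norm_num)] at h4
    linarith
  obtain ⟨r1, r2⟩ := hlast l l' hu b1
  obtain ⟨s1, s2⟩ := hlast l'.reverse l.reverse hwc b2
  have hrev : (l ++ l').reverse = l'.reverse ++ l.reverse := List.reverse_append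
  have htr := congrArg nsq (transpose_wordProd_mulVec hT (l ++ l') w)
  rw [nsq_conj2, hrev] at htr
  have f1 := frobSq_wordProd_le hG hA (l ++ l') hu
  have f2 := frobSq_wordProd_le hG hA (l'.reverse ++ l.reverse) hwc
  rw [← hrev, frobSq_wordProd_reverse hT, hrev, ← htr] at f2
  rw [← htr] at s1
  have q1 := orbitSum_inv_nonneg (G := G) (l ++ l') u
  have q2 := orbitSum_inv_nonneg (G := G) (l'.reverse ++ l.reverse) (conj2 w)
  have q3 := orbitSum_inv_nonneg (G := G) l u
  have q4 := orbitSum_inv_nonneg (G := G) l'.reverse (conj2 w)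
  obtain ⟨hne, hle⟩ := opNorm_div_dot2_le (det_wordProd hG (l ++ l')) hu hw
    (by positivity) (by positivity) r1 s1 f1 f2
  have hle' : opNorm (wordProd G (l ++ l')) / |dot2 ((wordProd G (l ++ l')).mulVec u) w| ≤
      (16 * A ^ 2) * (orbitSum G (fun x => (nsq x)⁻¹) l u *
        orbitSum G (fun x => (nsq x)⁻¹) l'.reverse (conj2 w)) := by
    refine hle.trans ?_
    calc _ ≤ 4 * ((A * (2 * orbitSum G (fun x => (nsq x)⁻¹) l u)) *
          (A * (2 * orbitSum G (fun x => (nsq x)⁻¹) l'.reverse (conj2 w)))) := by gcongr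
      _ = _ := by ring
  have hfin := truncRatio_le_rpow hK hs hs1 hne hle'
  rw [Real.mul_rpow (by positivity) (by positivity), Real.mul_rpow q3 q4, ← mul_assoc] at hfin
  have : K ^ (1 - s) * (16 * A ^ 2) ^ s * (orbitSum G (fun x => (nsq x)⁻¹) l u ^ s *
      orbitSum G (fun x => (nsq x)⁻¹) l'.reverse (conj2 w) ^ s) ≤ K ^ (1 - s) * (16 * A ^ 2) ^ s *
        (orbitSum G V l u * orbitSum G V l'.reverse (conj2 w)) := by
    gcongr
    · exact hS l hu0
    · exact hS l'.reverse hw0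
  linarith

lemma wordMean_truncRatio_le {V : (Fin 2 → ℝ) → ℝ} {s q c A K : ℝ} (hs : 0 < s) (hs1 : s < 1)
    (hq : 0 < q) (hq1 : q < 1)
    (hG : ∀ b, (G b).det = 1) (hA : ∀ b, frobSq (G b) ≤ A)
    (hT : ∀ b v, (G b).transpose.mulVec v = conj2 ((G b).mulVec (conj2 v)))
    (hV : ∀ v, 0 < nsq v → nsq v ^ (-s) ≤ V v) (hVc : ∀ v, 0 < nsq v → V v ≤ c * nsq v ^ (-s))
    (hVq : ∀ v, 0 < nsq v → (V ((G true).mulVec v) + V ((G false).mulVec v)) / 2 ≤ q * V v)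
    (hK : 1 < K) {u w : Fin 2 → ℝ} (hu : nsq u = 1) (hw : nsq w = 1) (n k : ℕ) :
    wordMean (n + k) (fun l => truncRatio K (wordProd G l) u w) ≤
      K * 4 ^ s * (c / (1 - q)) * (q ^ n + q ^ k) +
        K ^ (1 - s) * (16 * A ^ 2) ^ s * (c / (1 - q)) ^ 2 := by
  have hq' : 0 < 1 - q := by linarith
  have hA1 : 1 ≤ A := (one_le_frobSq (hG true)).trans (hA true)
  have hwc : nsq (conj2 w) = 1 := by rw [nsq_conj2, hw]
  have hV0 : ∀ v, 0 < nsq v → 0 ≤ V v := fun v hv => le_trans (by positivity) (hV v hv)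
  have hone : ∀ v, nsq v = 1 → V v ≤ c := by
    intro v hv
    have := hVc v (by linarith)
    rwa [hv, Real.one_rpow, mul_one] at this
  have hsum : ∀ (n : ℕ) {v : Fin 2 → ℝ}, 0 < nsq v →
      wordMean n (fun l => orbitSum G V l v) ≤ V v / (1 - q) :=
    fun n v hv => wordMean_orbitSum_le hq1 hG hV0 hVq n hv
  have htail : ∀ (n k : ℕ) {v : Fin 2 → ℝ}, nsq v = 1 →
      wordMean n (fun l => wordMean k (fun l' => orbitSum G V l' ((wordProd G l).mulVec v))) ≤
        c / (1 - q) * q ^ n := by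
    intro n k v hv
    have hv0 : 0 < nsq v := by linarith
    calc _ ≤ wordMean n (fun l => (1 - q)⁻¹ * V ((wordProd G l).mulVec v)) :=
          wordMean_mono fun l => by
            rw [mul_comm, ← div_eq_mul_inv]
            exact hsum k (nsq_mulVec_pos (det_wordProd hG l) hv0)
      _ ≤ (1 - q)⁻¹ * (q ^ n * c) := by
          rw [wordMean_const_mul]
          gcongr
          exact (wordMean_wordProd_le hq hG hVq n hv0).trans (by gcongr; exact hone v hv)
      _ = _ := by ring
  have hX : wordMean n (fun l => wordMean k (fun l' =>
      orbitSum G V l.reverse ((wordProd G l'.reverse).mulVec (conj2 w)))) ≤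
        c / (1 - q) * q ^ k := by
    rw [wordMean_comm,
      wordMean_reverse k (fun l' => wordMean n (fun l =>
        orbitSum G V l.reverse ((wordProd G l').mulVec (conj2 w))))]
    simp only [fun x : Fin 2 → ℝ => wordMean_reverse n (fun l => orbitSum G V l x)]
    exact htail k n hwc
  have hS0 : ∀ (k : List Bool) {v : Fin 2 → ℝ}, 0 < nsq v → 0 ≤ orbitSum G V k v :=
    fun k v hv => (Real.rpow_nonneg (orbitSum_inv_nonneg k v) s).trans
      (orbitSum_inv_rpow_le hs hs1 hG hV k hv)
  have hunit : ∀ (n : ℕ) {v : Fin 2 → ℝ}, nsq v = 1 →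
      wordMean n (fun l => orbitSum G V l v) ≤ c / (1 - q) := fun n v hv =>
    (hsum n (by linarith)).trans (div_le_div_of_nonneg_right (hone v hv) hq'.le)
  have hnn : 0 ≤ wordMean n (fun l => orbitSum G V l u) := by
    rw [← wordMean_const n 0]
    exact wordMean_mono fun l => hS0 l (by linarith)
  have hc : 0 ≤ c / (1 - q) := hnn.trans (hunit n hu)
  have hprod : wordMean n (fun l => wordMean k (fun l' =>
      orbitSum G V l u * orbitSum G V l'.reverse (conj2 w))) ≤ (c / (1 - q)) ^ 2 := by
    simp only [wordMean_const_mul]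
    rw [wordMean_reverse k (fun l' => orbitSum G V l' (conj2 w))]
    simp only [mul_comm _ (wordMean k _), wordMean_const_mul]
    rw [pow_two]
    exact mul_le_mul (hunit k hwc) (hunit n hu) hnn hc
  rw [wordMean_append]
  refine (wordMean_mono fun l => wordMean_mono fun l' =>
    truncRatio_wordProd_le hs hs1 hG hA hT hV hK hu hw l l').trans ?_
  simp only [wordMean_add, wordMean_const_mul] at hprod ⊢
  have e1 := mul_le_mul_of_nonneg_left (htail n k hu) (by positivity : 0 ≤ K * 4 ^ s)
  have e2 := mul_le_mul_of_nonneg_left hX (by positivity : 0 ≤ K * 4 ^ s)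
  have e3 := mul_le_mul_of_nonneg_left hprod
    (by positivity : 0 ≤ K ^ (1 - s) * (16 * A ^ 2) ^ s)
  calc _ ≤ _ := add_le_add (add_le_add e1 e2) e3
    _ = _ := by ring

end words

lemma det_gE (lam E x : ℝ) : (gE lam E x).det = 1 := by
  simp [gE, Matrix.det_fin_two]

lemma transpose_gE_mulVec (lam E x : ℝ) (v : Fin 2 → ℝ) :
    (gE lam E x).transpose.mulVec v = conj2 ((gE lam E x).mulVec (conj2 v)) := by
  ext i
  fin_cases i
  · change (gE lam E x).transpose.mulVec v 0 = conj2 ((gE lam E x).mulVec (conj2 v)) 0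
    simp only [conj2_zero, conj2_one, mulVec_zero_apply, Matrix.transpose_apply]
    simp [gE]
  · change (gE lam E x).transpose.mulVec v 1 = conj2 ((gE lam E x).mulVec (conj2 v)) 1
    simp only [conj2_zero, conj2_one, mulVec_one_apply, Matrix.transpose_apply]
    simp [gE]

lemma nsq_eq_one_of_norm2 {u : Fin 2 → ℝ} (hu : norm2 u = 1) : nsq u = 1 := by
  have h : norm2 u ^ 2 = nsq u := Real.sq_sqrt (nsq_nonneg u)
  rw [← h, hu, one_pow]

lemma average_truncRatio_eq (lam E K : ℝ) (N : ℕ) (u w : Fin 2 → ℝ) :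
    (∑ σ : Fin N → Bool, (if dot2 ((transferB lam E N σ).mulVec u) w = 0 then K
        else min (opNorm (transferB lam E N σ) /
          |dot2 ((transferB lam E N σ).mulVec u) w|) K)) / 2 ^ N
      = wordMean N (fun l => truncRatio K (wordProd (fun b => gE lam E (bval b)) l) u w) := by
  rw [← sum_cube_div_eq_wordMean]
  simp only [transferB_eq_wordProd]
  rfl

/-- For every `γ < 1` there is `λ₀ > 0` such that for `0 < λ < λ₀` and
`δ₀ < |E| < 2 - δ₀` there is a constant `C`: for every `K > 1` there is `N₀(K)`
such that for all `N ≥ N₀` and all unit vectors `u, w`,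
`𝔼_ε[min(‖M_N(E;ε)‖ / |⟨M_N(E;ε)u, w⟩|, K)] ≤ C K^{1-γ}` (the minimum being
interpreted as `K` when `⟨M_N u, w⟩ = 0`). -/
theorem expected_green_kernel_bound
    (δ₀ : ℝ) (hδ₀ : 0 < δ₀) (hδ₀' : δ₀ < 1) :
    ∀ γ : ℝ, γ < 1 →
      ∃ lam0 : ℝ, 0 < lam0 ∧
        ∀ lam : ℝ, 0 < lam → lam < lam0 →
          ∀ E : ℝ, δ₀ < |E| → |E| < 2 - δ₀ →
            ∃ C : ℝ, 0 < C ∧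
              ∀ K : ℝ, 1 < K →
                ∃ N₀ : ℕ, ∀ N : ℕ, N₀ ≤ N →
                  ∀ u w : Fin 2 → ℝ, norm2 u = 1 → norm2 w = 1 →
                    (∑ σ : Fin N → Bool,
                        (if dot2 ((transferB lam E N σ).mulVec u) w = 0 then K
                          else min (opNorm (transferB lam E N σ) /
                            |dot2 ((transferB lam E N σ).mulVec u) w|) K)) /
                      2 ^ N ≤ C * K ^ (1 - γ) := by
  intro s hs1
  rcases le_or_gt s 0 with hs | hs
  · refine ⟨1, one_pos, fun lam _ _ E _ _ => ⟨1, one_pos, fun K hK => ⟨0, fun N _ u w _ _ => ?_⟩⟩⟩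
    rw [average_truncRatio_eq, one_mul]
    calc _ ≤ wordMean N (fun _ => K) := wordMean_mono fun l => truncRatio_le _ _ _ _
      _ = K ^ (1 : ℝ) := by rw [wordMean_const, Real.rpow_one]
      _ ≤ K ^ (1 - s) := Real.rpow_le_rpow_of_exponent_le hK.le (by linarith)
  obtain ⟨lam0, hlam0, H⟩ := exists_lyapunov hδ₀ hδ₀' hs hs1
  refine ⟨lam0, hlam0, fun lam hlam hlam' E hE hE' => ?_⟩
  obtain ⟨V, q, c, hq, hq1, hc, hV⟩ := H lam hlam hlam' E hE hE'
  have hq' : 0 < 1 - q := by linarith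
  set A := frobSq (gE lam E (bval true)) + frobSq (gE lam E (bval false)) with hAdef
  have hA : ∀ b, frobSq (gE lam E (bval b)) ≤ A := by
    have h1 := frobSq_nonneg (gE lam E (bval true))
    have h2 := frobSq_nonneg (gE lam E (bval false))
    intro b
    cases b <;> linarith
  have hA0 : 0 ≤ A := (frobSq_nonneg _).trans (hA true)
  refine ⟨1 + (16 * A ^ 2) ^ s * (c / (1 - q)) ^ 2, by positivity, fun K hK => ?_⟩
  have hD : 0 < K * 4 ^ s * (c / (1 - q)) := by positivity
  obtain ⟨m, hm⟩ := exists_pow_lt_of_lt_one (show 0 < 1 / (2 * (K * 4 ^ s * (c / (1 - q)))) by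
    positivity) hq1
  refine ⟨2 * m, fun N hN u w hu hw => ?_⟩
  obtain ⟨k, rfl⟩ : ∃ k, N = m + k := ⟨N - m, by omega⟩
  rw [average_truncRatio_eq]
  refine (wordMean_truncRatio_le hs hs1 hq hq1 (fun b => det_gE _ _ _) hA
    (fun b v => transpose_gE_mulVec _ _ _ v) (fun v hv => (hV v hv).1)
    (fun v hv => (hV v hv).2.1) (fun v hv => (hV v hv).2.2) hK (nsq_eq_one_of_norm2 hu)
    (nsq_eq_one_of_norm2 hw) m k).trans ?_
  have hk : q ^ k ≤ q ^ m := pow_le_pow_of_le_one hq.le hq1.le (by omega)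
  have h1 : K * 4 ^ s * (c / (1 - q)) * (q ^ m + q ^ k) ≤ 1 := by
    rw [lt_div_iff₀ (by positivity)] at hm
    nlinarith
  have h2 : 1 ≤ K ^ (1 - s) := Real.one_le_rpow hK.le (by linarith)
  linarith
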